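/- Let A = (A_1, A_2, …, A_d) be an irreducible d-tuple of 2×2 complex matrices, let x ∈ ℂ², define A_j(z) := A_j(I_2 + z · x x*), and let S_A := { z ∈ ℂ \ {0} : the tuple A(z) is jointly similar to A }. If S_A is nonempty, then A(z) is jointly similar to A for every z ∈ ℂ. -/

import Mathlib

open Matrix

/-- Two `d`-tuples are jointly similar if a single invertible matrix conjugates one
to the other componentwise. -/
def JointlySimilar {d n : ℕ} (Z W : Fin d → Matrix (Fin n) (Fin n) ℂ) : Prop :=
  ∃ S : Matrix (Fin n) (Fin n) ℂ, IsUnit S ∧ ∀ j, W j = S * Z j * S⁻¹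

/-- A `d`-tuple is irreducible if the only jointly invariant subspaces are `{0}` and `ℂⁿ`. -/
def IrreducibleTuple {d n : ℕ} (Z : Fin d → Matrix (Fin n) (Fin n) ℂ) : Prop :=
  ∀ W : Submodule ℂ (Fin n → ℂ), (∀ j, ∀ v ∈ W, (Z j).mulVec v ∈ W) → W = ⊥ ∨ W = ⊤

/-- The perturbed tuple `A(z)` with `Aⱼ(z) = Aⱼ (I + z · x x*)`. -/
noncomputable def pertTuple {d n : ℕ} (A : Fin d → Matrix (Fin n) (Fin n) ℂ)
    (x : Fin n → ℂ) (z : ℂ) : Fin d → Matrix (Fin n) (Fin n) ℂ :=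
  fun j => A j * (1 + z • Matrix.vecMulVec x (star x))

/-- An irreducible tuple of `2 × 2` matrices has no common eigenvector. -/
theorem IrreducibleTuple.not_common_eigenvector {d : ℕ} {A : Fin d → Matrix (Fin 2) (Fin 2) ℂ}
    (hA : IrreducibleTuple A) {v : Fin 2 → ℂ} (hv : v ≠ 0) :
    ¬ ∀ j, v 0 * (A j *ᵥ v) 1 = v 1 * (A j *ᵥ v) 0 := by
  intro h
  have mem_span {w : Fin 2 → ℂ} (hw : v 0 * w 1 = v 1 * w 0) : w ∈ Submodule.span ℂ {v} := by
    rw [Submodule.mem_span_singleton]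
    by_cases h0 : v 0 = 0
    · have h1 : v 1 ≠ 0 := fun h1 => hv (by ext i; fin_cases i <;> simp [h0, h1])
      refine ⟨w 1 / v 1, ?_⟩
      have hw0 : w 0 = 0 := by simpa [h0, h1] using hw.symm
      ext i; fin_cases i <;> simp [h0, h1, hw0]
    · refine ⟨w 0 / v 0, ?_⟩
      ext i; fin_cases i
      · simp [h0]
      · simp only [Fin.mk_one, Pi.smul_apply, smul_eq_mul]
        field_simp
        linear_combination -hw
  rcases hA (Submodule.span ℂ {v}) (fun j w hw => by
    obtain ⟨c, rfl⟩ := Submodule.mem_span_singleton.mp hw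
    rw [mulVec_smul]
    exact Submodule.smul_mem _ c (mem_span (h j))) with hbot | htop
  · exact hv (Submodule.span_singleton_eq_bot.mp hbot)
  · have hcard := finrank_span_singleton (K := ℂ) hv
    rw [htop] at hcard
    simp at hcard

theorem JointlySimilar.trace_eq {d n : ℕ} {Z W : Fin d → Matrix (Fin n) (Fin n) ℂ}
    (h : JointlySimilar Z W) (i : Fin d) : (W i).trace = (Z i).trace := by
  obtain ⟨S, hS, hW⟩ := h
  have hdet := (isUnit_iff_isUnit_det S).mp hS
  rw [hW, trace_mul_comm, nonsing_inv_mul_cancel_left _ _ hdet]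

theorem JointlySimilar.trace_mul_eq {d n : ℕ} {Z W : Fin d → Matrix (Fin n) (Fin n) ℂ}
    (h : JointlySimilar Z W) (i j : Fin d) : (W i * W j).trace = (Z i * Z j).trace := by
  obtain ⟨S, hS, hW⟩ := h
  have hdet := (isUnit_iff_isUnit_det S).mp hS
  have hmul : W i * W j = S * (Z i * Z j) * S⁻¹ := by
    simp only [hW, Matrix.mul_assoc, nonsing_inv_mul_cancel_left _ _ hdet]
  rw [hmul, trace_mul_comm, nonsing_inv_mul_cancel_left _ _ hdet]

theorem JointlySimilar.refl {d n : ℕ} (Z : Fin d → Matrix (Fin n) (Fin n) ℂ) :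
    JointlySimilar Z Z :=
  ⟨1, isUnit_one, fun j => by simp⟩

/-- A nontrivial rank-one perturbation of an irreducible tuple of `2 × 2` matrices is never
jointly similar to it. -/
theorem IrreducibleTuple.not_jointlySimilar_pertTuple {d : ℕ}
    {A : Fin d → Matrix (Fin 2) (Fin 2) ℂ} (hA : IrreducibleTuple A) {x : Fin 2 → ℂ}
    (hx : x ≠ 0) {z : ℂ} (hz : z ≠ 0) : ¬ JointlySimilar A (pertTuple A x z) := by
  intro hsim
  have hN : x 0 * star (x 0) + x 1 * star (x 1) ≠ 0 := by
    open scoped ComplexOrder in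
    have := (dotProduct_self_star_eq_zero (v := x)).not.mpr hx
    simpa [dotProduct, Fin.sum_univ_two] using this
  -- `α` and `β` are the forms `y* Aⱼ x` and `x* Aⱼ y`, with `y` orthogonal to `x`.
  let y : Fin 2 → ℂ := ![-star (x 1), star (x 0)]
  let α : Fin d → ℂ := fun j => x 0 * (A j *ᵥ x) 1 - x 1 * (A j *ᵥ x) 0
  let β : Fin d → ℂ := fun j => star (x 0) * (A j *ᵥ y) 0 + star (x 1) * (A j *ᵥ y) 1
  have hu (j : Fin d) : star (x 0) * (A j 0 0 * x 0 + A j 0 1 * x 1)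
      + star (x 1) * (A j 1 0 * x 0 + A j 1 1 * x 1) = 0 := by
    have h := hsim.trace_eq j
    simp only [pertTuple, trace_fin_two, mul_apply, Fin.sum_univ_two, Matrix.add_apply,
      Matrix.smul_apply, vecMulVec_apply, one_apply, Pi.star_apply, smul_eq_mul, if_true,
      zero_ne_one, one_ne_zero, if_false] at h
    apply mul_left_cancel₀ hz
    linear_combination h
  have hαβ (i j : Fin d) : α i * β j + α j * β i = 0 := by
    have h := hsim.trace_mul_eq i j
    simp only [pertTuple, trace_fin_two, mul_apply, Fin.sum_univ_two, Matrix.add_apply,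
      Matrix.smul_apply, vecMulVec_apply, one_apply, Pi.star_apply, smul_eq_mul, if_true,
      zero_ne_one, one_ne_zero, if_false] at h
    apply mul_left_cancel₀ hz
    simp only [α, β, y, mulVec, dotProduct, Fin.sum_univ_two, cons_val_zero,
      cons_val_one]
    linear_combination (x 0 * star (x 0) + x 1 * star (x 1)) * h
      - (2 * z + (x 0 * star (x 0) + x 1 * star (x 1)) * z ^ 2)
        * (star (x 0) * (A j 0 0 * x 0 + A j 0 1 * x 1)
          + star (x 1) * (A j 1 0 * x 0 + A j 1 1 * x 1)) * hu i
  by_cases hα : ∀ j, α j = 0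
  · exact hA.not_common_eigenvector hx fun j => sub_eq_zero.mp (hα j)
  · push Not at hα
    obtain ⟨i, hi⟩ := hα
    have hβi : β i = 0 := by
      have h : α i * β i = 0 := by linear_combination hαβ i i / 2
      exact (mul_eq_zero.mp h).resolve_left hi
    have hβ (j : Fin d) : β j = 0 := by
      have h : α i * β j = 0 := by linear_combination hαβ i j - α j * hβi
      exact (mul_eq_zero.mp h).resolve_left hi
    have hy : y ≠ 0 := by
      intro hy
      have h0 : star (x 0) = 0 := congrFun hy 1
      have h1 : -star (x 1) = 0 := congrFun hy 0
      exact hN (by linear_combination x 0 * h0 - x 1 * h1)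
    refine hA.not_common_eigenvector hy fun j => ?_
    have h : star (x 0) * (A j *ᵥ y) 0 + star (x 1) * (A j *ᵥ y) 1 = 0 := hβ j
    change -star (x 1) * (A j *ᵥ y) 1 = star (x 0) * (A j *ᵥ y) 0
    linear_combination -h

theorem stmt17 (d : ℕ) (A : Fin d → Matrix (Fin 2) (Fin 2) ℂ)
    (hirr : IrreducibleTuple A) (x : Fin 2 → ℂ)
    -- `S_A = { z ≠ 0 : A(z) is jointly similar to A }` is nonempty:
    (hne : ∃ z₀ : ℂ, z₀ ≠ 0 ∧ JointlySimilar A (pertTuple A x z₀)) :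
    ∀ z : ℂ, JointlySimilar A (pertTuple A x z) := by
  obtain ⟨z₀, hz₀, hsim⟩ := hne
  intro z
  have hx : x = 0 := by
    by_contra hx
    exact hirr.not_jointlySimilar_pertTuple hx hz₀ hsim
  have hpert : pertTuple A x z = A := by
    ext1 j
    simp [pertTuple, hx]
  rw [hpert]
  exact JointlySimilar.refl A
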